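/- arXiv:1511.09208 — 5 statements merged into one kernel-verified Lean document; each statement's English description precedes it below -/
import Mathlib

section
/- Suppose r is an α-approximate oblivious rounding scheme for the canonical LP relaxation of a d-sparse packing integer program (α ≥ 1). Consider the randomized pay-your-bid mechanism that, on bids b, computes an exact declared-welfare-maximizing fractional solution x̂(b) and outputs an integral solution X ∼ r(x̂(b)). Let v be nonnegative valuation values and let b be a pure Nash equilibrium of the expected-utility game under v (for every bidder i and every nonnegative bid vector b'_i, U_i(b,v) ≥ U_i((b'_i,b_{-i}),v)) at which U_i(b,v) ≥ 0 for all i. Then the expected welfare satisfies E_{X∼r(x̂(b))}[ ∑_{i∈N}∑_{k∈K} v_{i,k}·X_{i,k} ] ≥ (1/(2α(d+1)))·max over integral feasible x of ∑_{i,k} v_{i,k}·x_{i,k}. -/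
open Finset

/-- A fractional solution of a packing integer program, feasible for capacities `c`. -/
def PIPFeasible {N K L : Type*} [Fintype N] [Fintype K] [Fintype L]
    (A : L → N → K → ℝ) (c : L → ℝ) (x : N → K → ℝ) : Prop :=
  (∀ i k, 0 ≤ x i k) ∧ (∀ i, ∑ k, x i k ≤ 1) ∧
    ∀ ℓ, ∑ i, ∑ k, A ℓ i k * x i k ≤ c ℓ

/-- The share of the capacity of `ℓ` that bidder `i` consumes under `x`. -/
noncomputable def capacityShare {N K L : Type*} [Fintype K]
    (A : L → N → K → ℝ) (c : L → ℝ) (x : N → K → ℝ) (i : N) (ℓ : L) : ℝ :=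
  (∑ k, A ℓ i k * x i k) / c ℓ

/-- The total capacity share consumed by bidder `i` on the constraints that involve `(j, k)`. -/
noncomputable def conflictShare {N K L : Type*} [Fintype K] [Fintype L]
    (A : L → N → K → ℝ) (c : L → ℝ) (x : N → K → ℝ) (i j : N) (k : K) : ℝ :=
  ∑ ℓ with A ℓ j k ≠ 0, capacityShare A c x i ℓ

section PackingIntegerProgram

variable {N K L : Type*} [Fintype N] [Fintype K] [Fintype L]
  {A : L → N → K → ℝ} {c : L → ℝ} {x z : N → K → ℝ}

theorem capacityShare_nonneg (hA : ∀ ℓ i k, 0 ≤ A ℓ i k) (hc : ∀ ℓ, 0 < c ℓ)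
    (hx : PIPFeasible A c x) (i : N) (ℓ : L) : 0 ≤ capacityShare A c x i ℓ :=
  div_nonneg (sum_nonneg fun k _ => mul_nonneg (hA ℓ i k) (hx.1 i k)) (hc ℓ).le

theorem sum_capacityShare_le_one (hc : ∀ ℓ, 0 < c ℓ) (hx : PIPFeasible A c x) (ℓ : L) :
    ∑ i, capacityShare A c x i ℓ ≤ 1 := by
  simp only [capacityShare]
  rw [← sum_div, div_le_one (hc ℓ)]
  exact hx.2.2 ℓ

theorem capacityShare_le_one (hA : ∀ ℓ i k, 0 ≤ A ℓ i k) (hc : ∀ ℓ, 0 < c ℓ)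
    (hx : PIPFeasible A c x) (i : N) (ℓ : L) : capacityShare A c x i ℓ ≤ 1 :=
  (single_le_sum (f := fun i => capacityShare A c x i ℓ)
    (fun j _ => capacityShare_nonneg hA hc hx j ℓ) (mem_univ i)).trans
    (sum_capacityShare_le_one hc hx ℓ)

theorem conflictShare_nonneg (hA : ∀ ℓ i k, 0 ≤ A ℓ i k) (hc : ∀ ℓ, 0 < c ℓ)
    (hx : PIPFeasible A c x) (i j : N) (k : K) : 0 ≤ conflictShare A c x i j k :=
  sum_nonneg fun ℓ _ => capacityShare_nonneg hA hc hx i ℓ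

theorem sum_conflictShare_le {d : ℕ} (hd : ∀ i k, (univ.filter fun ℓ => A ℓ i k ≠ 0).card ≤ d)
    (hc : ∀ ℓ, 0 < c ℓ) (hx : PIPFeasible A c x) (j : N) (k : K) :
    ∑ i, conflictShare A c x i j k ≤ d := by
  simp only [conflictShare]
  rw [sum_comm]
  calc ∑ ℓ with A ℓ j k ≠ 0, ∑ i, capacityShare A c x i ℓ
      ≤ ∑ ℓ with A ℓ j k ≠ 0, (1 : ℝ) :=
        sum_le_sum fun ℓ _ => sum_capacityShare_le_one hc hx ℓ
    _ ≤ d := by simpa using hd j k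

/-- Giving bidder `i` its part of `x` and scaling down the other bidders' parts of `z` according
to their conflicts with `i` preserves feasibility. -/
theorem PIPFeasible.update_conflict [DecidableEq N] (hA : ∀ ℓ i k, 0 ≤ A ℓ i k)
    (hc : ∀ ℓ, 0 < c ℓ) (hx : PIPFeasible A c x) (hz : PIPFeasible A c z) (i : N) :
    PIPFeasible A c (Function.update
      (fun j k => z j k * max 0 (1 - conflictShare A c x i j k)) i (x i)) := by
  refine ⟨fun j k => ?_, fun j => ?_, fun ℓ => ?_⟩
  · rcases eq_or_ne j i with rfl | h
    · simpa using hx.1 j k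
    · simpa [h] using mul_nonneg (hz.1 j k) (le_max_left _ _)
  · rcases eq_or_ne j i with rfl | h
    · simpa using hx.2.1 j
    · simp only [Function.update_of_ne h]
      refine (sum_le_sum fun k _ => mul_le_of_le_one_right (hz.1 j k) ?_).trans (hz.2.1 j)
      exact max_le zero_le_one (by linarith [conflictShare_nonneg hA hc hx i j k])
  · have hshare : 0 ≤ 1 - capacityShare A c x i ℓ :=
      sub_nonneg.2 (capacityShare_le_one hA hc hx i ℓ)
    have hscale : ∀ j k, A ℓ j k * (z j k * max 0 (1 - conflictShare A c x i j k)) ≤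
        (1 - capacityShare A c x i ℓ) * (A ℓ j k * z j k) := by
      intro j k
      by_cases h : A ℓ j k = 0
      · simp [h]
      · have hle : capacityShare A c x i ℓ ≤ conflictShare A c x i j k :=
          single_le_sum (f := capacityShare A c x i)
            (fun m _ => capacityShare_nonneg hA hc hx i m) (by simpa using h)
        rw [← mul_assoc, mul_comm (1 - capacityShare A c x i ℓ)]
        exact mul_le_mul_of_nonneg_left (max_le hshare (by linarith))
          (mul_nonneg (hA ℓ j k) (hz.1 j k))
    have hi : ∑ k, A ℓ i k * x i k = capacityShare A c x i ℓ * c ℓ :=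
      (div_mul_cancel₀ _ (hc ℓ).ne').symm
    rw [← add_sum_erase _ _ (mem_univ i), Function.update_self, hi]
    calc _ ≤ capacityShare A c x i ℓ * c ℓ +
          ∑ j ∈ univ.erase i, ∑ k, (1 - capacityShare A c x i ℓ) * (A ℓ j k * z j k) := by
          refine add_le_add_right (sum_le_sum fun j hj => sum_le_sum fun k _ => ?_) _
          rw [Function.update_of_ne (ne_of_mem_erase hj)]
          exact hscale j k
      _ ≤ capacityShare A c x i ℓ * c ℓ +
          ∑ j, ∑ k, (1 - capacityShare A c x i ℓ) * (A ℓ j k * z j k) := by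
          gcongr
          · exact fun j _ _ => sum_nonneg fun k _ =>
              mul_nonneg hshare (mul_nonneg (hA ℓ j k) (hz.1 j k))
          · exact erase_subset _ _
      _ = capacityShare A c x i ℓ * c ℓ +
          (1 - capacityShare A c x i ℓ) * ∑ j, ∑ k, A ℓ j k * z j k := by simp only [mul_sum]
      _ ≤ capacityShare A c x i ℓ * c ℓ + (1 - capacityShare A c x i ℓ) * c ℓ := by
          gcongr
          exact hz.2.2 ℓ
      _ = c ℓ := by ring

/-- A bidder who deviates to `b'` wins declared value at least that of its part of `x`, minus its
current declared value and the declared value it displaces. -/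
theorem deviation_value_ge [DecidableEq N] (hA : ∀ ℓ i k, 0 ≤ A ℓ i k) (hc : ∀ ℓ, 0 < c ℓ)
    {y : N → K → ℝ} {b : N → K → ℝ} (hb : ∀ i k, 0 ≤ b i k) (i : N) (b' : K → ℝ)
    (hx : PIPFeasible A c x) (hz : PIPFeasible A c z) (hy : PIPFeasible A c y)
    (hzopt : ∀ u, PIPFeasible A c u → ∑ j, ∑ k, b j k * u j k ≤ ∑ j, ∑ k, b j k * z j k)
    (hyopt : ∀ u, PIPFeasible A c u → ∑ j, ∑ k, Function.update b i b' j k * u j k ≤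
      ∑ j, ∑ k, Function.update b i b' j k * y j k) :
    ∑ k, b' k * x i k - ∑ k, b i k * z i k - ∑ j, ∑ k, b j k * z j k * conflictShare A c x i j k ≤
      ∑ k, b' k * y i k := by
  have hbz : ∀ j k, 0 ≤ b j k * z j k := fun j k => mul_nonneg (hb j k) (hz.1 j k)
  have hdev := hyopt _ (hx.update_conflict hA hc hz i)
  rw [← add_sum_erase _ _ (mem_univ i), ← add_sum_erase univ (fun j => ∑ k, _ * y j k) (mem_univ i)]
    at hdev
  simp only [Function.update_self] at hdev
  have hlow : ∑ j ∈ univ.erase i, ∑ k, b j k * z j k -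
      ∑ j, ∑ k, b j k * z j k * conflictShare A c x i j k ≤
      ∑ j ∈ univ.erase i, ∑ k, Function.update b i b' j k * Function.update
        (fun j k => z j k * max 0 (1 - conflictShare A c x i j k)) i (x i) j k := by
    have hsub : ∑ j ∈ univ.erase i, ∑ k, b j k * z j k * conflictShare A c x i j k ≤
        ∑ j, ∑ k, b j k * z j k * conflictShare A c x i j k :=
      sum_le_sum_of_subset_of_nonneg (erase_subset _ _) fun j _ _ => sum_nonneg fun k _ =>
        mul_nonneg (hbz j k) (conflictShare_nonneg hA hc hx i j k)
    refine (sub_le_sub_left hsub _).trans ?_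
    rw [← sum_sub_distrib]
    refine sum_le_sum fun j hj => ?_
    rw [← sum_sub_distrib, Function.update_of_ne (ne_of_mem_erase hj),
      Function.update_of_ne (ne_of_mem_erase hj)]
    refine sum_le_sum fun k _ => ?_
    have := mul_le_mul_of_nonneg_left (le_max_right 0 (1 - conflictShare A c x i j k)) (hbz j k)
    linarith
  have hupp : ∑ j ∈ univ.erase i, ∑ k, Function.update b i b' j k * y j k ≤
      ∑ j, ∑ k, b j k * y j k := by
    refine (sum_congr rfl fun j hj => ?_).trans_le
      (sum_le_sum_of_subset_of_nonneg (erase_subset i univ) fun j _ _ => sum_nonneg fun k _ =>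
        mul_nonneg (hb j k) (hy.1 j k))
    rw [Function.update_of_ne (ne_of_mem_erase hj)]
  have hsplit := add_sum_erase univ (fun j => ∑ k, b j k * z j k) (mem_univ i)
  linarith [hzopt y hy]

/-- The total declared value displaced by `x` is at most `d` times the declared value of `z`. -/
theorem sum_displaced_le {d : ℕ} (hd : ∀ i k, (univ.filter fun ℓ => A ℓ i k ≠ 0).card ≤ d)
    (hc : ∀ ℓ, 0 < c ℓ) {b : N → K → ℝ} (hb : ∀ i k, 0 ≤ b i k)
    (hx : PIPFeasible A c x) (hz : PIPFeasible A c z) :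
    ∑ i, ∑ j, ∑ k, b j k * z j k * conflictShare A c x i j k ≤ d * ∑ j, ∑ k, b j k * z j k := by
  rw [sum_comm, mul_sum]
  refine sum_le_sum fun j _ => ?_
  rw [sum_comm, mul_sum]
  refine sum_le_sum fun k _ => ?_
  rw [← mul_sum, mul_comm (d : ℝ)]
  exact mul_le_mul_of_nonneg_left (sum_conflictShare_le hd hc hx j k)
    (mul_nonneg (hb j k) (hz.1 j k))

end PackingIntegerProgram

/-- Price of Anarchy of the relax-and-round pay-your-bid mechanism for
`d`-sparse packing integer programs: at any pure Nash equilibrium (of the expected-utility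
game) with nonnegative utilities, the expected welfare is at least a
`1/(2α(d+1))`-fraction of the optimal integral welfare. -/
theorem pip_relax_and_round_poa
    {N K L : Type*} [Fintype N] [Fintype K] [Fintype L] [DecidableEq N] [DecidableEq K]
    (d : ℕ) (A : L → N → K → ℝ) (hA : ∀ ℓ i k, 0 ≤ A ℓ i k)
    (hd : ∀ i k, (univ.filter fun ℓ => A ℓ i k ≠ 0).card ≤ d)
    (c : L → ℝ) (hc : ∀ ℓ, 0 < c ℓ)
    (xhat : (N → K → ℝ) → (N → K → ℝ))
    (hfeas : ∀ b : N → K → ℝ, (∀ i k, 0 ≤ b i k) → PIPFeasible A c (xhat b))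
    (hopt : ∀ b : N → K → ℝ, (∀ i k, 0 ≤ b i k) → ∀ y : N → K → ℝ, PIPFeasible A c y →
      ∑ i, ∑ k, b i k * xhat b i k ≥ ∑ i, ∑ k, b i k * y i k)
    (α : ℝ) (hα : 1 ≤ α)
    (r : (N → K → ℝ) → (N → K → Bool) → ℝ)
    (hr0 : ∀ x' : N → K → ℝ, PIPFeasible A c x' → ∀ X, 0 ≤ r x' X)
    (hr1 : ∀ x' : N → K → ℝ, PIPFeasible A c x' → ∑ X : N → K → Bool, r x' X = 1)
    (hrsupp : ∀ x' : N → K → ℝ, PIPFeasible A c x' → ∀ X : N → K → Bool, r x' X ≠ 0 →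
      PIPFeasible A c (fun i k => if X i k then 1 else 0))
    (hobl : ∀ x' : N → K → ℝ, PIPFeasible A c x' → ∀ (i : N) (w : K → ℝ), (∀ k, 0 ≤ w k) →
      ∑ X : N → K → Bool, r x' X * ∑ k, w k * (if X i k then (1 : ℝ) else 0)
        ≥ 1 / α * ∑ k, w k * x' i k)
    (v b : N → K → ℝ) (hv : ∀ i k, 0 ≤ v i k) (hb : ∀ i k, 0 ≤ b i k)
    (hNash : ∀ (i : N) (b' : K → ℝ), (∀ k, 0 ≤ b' k) →
      ∑ X : N → K → Bool, r (xhat b) X * ∑ k, (v i k - b i k) * (if X i k then (1 : ℝ) else 0)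
        ≥ ∑ X : N → K → Bool, r (xhat (Function.update b i b')) X *
            ∑ k, (v i k - b' k) * (if X i k then (1 : ℝ) else 0))
    (hIR : ∀ i : N, 0 ≤ ∑ X : N → K → Bool, r (xhat b) X *
      ∑ k, (v i k - b i k) * (if X i k then (1 : ℝ) else 0)) :
    ∑ X : N → K → Bool, r (xhat b) X * ∑ i, ∑ k, v i k * (if X i k then (1 : ℝ) else 0)
      ≥ 1 / (2 * α * ((d : ℝ) + 1)) *
        sSup {w : ℝ | ∃ X : N → K → Bool,
          PIPFeasible A c (fun i k => if X i k then 1 else 0) ∧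
          w = ∑ i, ∑ k, v i k * (if X i k then (1 : ℝ) else 0)} := by
  have hα0 : 0 < α := by linarith
  have hz := hfeas b hb
  set P : N → ℝ := fun i =>
    ∑ X : N → K → Bool, r (xhat b) X * ∑ k, b i k * (if X i k then (1 : ℝ) else 0) with hP
  set U : N → ℝ := fun i =>
    ∑ X : N → K → Bool, r (xhat b) X * ∑ k, (v i k - b i k) * (if X i k then (1 : ℝ) else 0) with hU
  set B : ℝ := ∑ i, ∑ k, b i k * xhat b i k with hB
  have hU0 : 0 ≤ ∑ i, U i := sum_nonneg fun i _ => hIR i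
  have hP0 : ∀ i, 1 / α * ∑ k, b i k * xhat b i k ≤ P i := fun i => hobl _ hz i _ (hb i)
  have hPB : 1 / α * B ≤ ∑ i, P i := by
    rw [hB, mul_sum]
    exact sum_le_sum fun i _ => hP0 i
  have hB0 : 0 ≤ B := sum_nonneg fun i _ => sum_nonneg fun k _ => mul_nonneg (hb i k) (hz.1 i k)
  have hPnn : 0 ≤ ∑ i, P i := le_trans (by positivity) hPB
  have hW : ∑ X : N → K → Bool, r (xhat b) X *
      ∑ i, ∑ k, v i k * (if X i k then (1 : ℝ) else 0) = ∑ i, U i + ∑ i, P i := by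
    rw [← sum_add_distrib]
    simp only [hU, hP, ← sum_add_distrib, ← mul_add, ← add_mul, sub_add_cancel]
    rw [sum_comm]
    simp only [mul_sum]
  have hd0 : (0 : ℝ) < 2 * α * ((d : ℝ) + 1) := by positivity
  rw [hW, ge_iff_le, one_div, inv_mul_le_iff₀ hd0]
  refine Real.sSup_le ?_ (by positivity)
  rintro w ⟨X, hX, rfl⟩
  set x : N → K → ℝ := fun i k => if X i k then 1 else 0 with hx
  have hdev : ∀ i, 1 / α * (∑ k, v i k / 2 * x i k - ∑ k, b i k * xhat b i k -
      ∑ j, ∑ k, b j k * xhat b j k * conflictShare A c x i j k) ≤ U i := by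
    intro i
    set b' : K → ℝ := fun k => v i k / 2 * x i k with hb'
    have hb'0 : ∀ k, 0 ≤ b' k := fun k =>
      mul_nonneg (div_nonneg (hv i k) zero_le_two) (hX.1 i k)
    have hhalf : ∀ k, b' k ≤ v i k - b' k := fun k => by
      have := hv i k
      simp only [hb', hx]
      split_ifs <;> linarith
    have hupd : ∀ j k, 0 ≤ Function.update b i b' j k := fun j k => by
      rcases eq_or_ne j i with rfl | h
      · simpa using hb'0 k
      · simpa [h] using hb j k
    have hy := hfeas _ hupd
    have hval := deviation_value_ge hA hc hb i b' hX hz hy (hopt b hb) (hopt _ hupd)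
    have hsq : ∑ k, b' k * x i k = ∑ k, v i k / 2 * x i k :=
      sum_congr rfl fun k _ => by simp only [hb', hx]; split_ifs <;> ring
    rw [hsq] at hval
    calc _ ≤ 1 / α * ∑ k, b' k * xhat (Function.update b i b') i k := by gcongr
      _ ≤ 1 / α * ∑ k, (v i k - b' k) * xhat (Function.update b i b') i k := by
          gcongr with k
          · exact hy.1 i k
          · exact hhalf k
      _ ≤ _ := hobl _ hy i _ fun k => (hb'0 k).trans (hhalf k)
      _ ≤ U i := hNash i b' hb'0
  have hsum := sum_le_sum fun i (_ : i ∈ univ) => hdev i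
  rw [← mul_sum, sum_sub_distrib, sum_sub_distrib] at hsum
  have hdisp := sum_displaced_le hd hc hb hX hz
  have hhalf : ∑ i, ∑ k, v i k / 2 * x i k = (∑ i, ∑ k, v i k * x i k) / 2 := by
    simp only [sum_div]
    exact sum_congr rfl fun i _ => sum_congr rfl fun k _ => by ring
  rw [hhalf, one_div, inv_mul_le_iff₀ hα0] at hsum
  rw [one_div, inv_mul_le_iff₀ hα0] at hPB
  have hBd : ((d : ℝ) + 1) * B ≤ ((d : ℝ) + 1) * (α * ∑ i, P i) := by gcongr
  have hUd : 0 ≤ (d : ℝ) * (α * ∑ i, U i) := by positivity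
  change ∑ i, ∑ k, v i k * x i k ≤ _
  linarith
end

section
/- The pay-your-bid mechanism that computes an optimal cycle cover is (1/2,3)-smooth for deviations to half the value: for every nonnegative valuation function v and bid function b on the edges, with deviations b'_e = (1/2)·v(e), ∑_{e} (v(e) − b'_e)·1[e ∈ edges(ĝ(b'_e, b_{-e}))] ≥ (1/2)·W^{v} − 3·∑_{e} b(e)·1[e ∈ edges(ĝ(b))], where both sums range over all ordered pairs e of distinct elements of V. -/
open Finset

/-- `derW b` is the maximum weight `W^b` of a cycle cover (derangement) of `V`
under the weight function `b`. -/
noncomputable def derW {V : Type*} [Fintype V] (b : V → V → ℝ) : ℝ :=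
  sSup {w : ℝ | ∃ σ : Equiv.Perm V, (∀ x, σ x ≠ x) ∧ w = ∑ x, b x (σ x)}

/-- A derangement `M` can be modified to use the edge `(u, w)` by rerouting only `u`,
the predecessor of `w`, and `w`. -/
theorem exists_derangement_through_edge {V : Type*} [DecidableEq V] (M : Equiv.Perm V)
    (hM : ∀ x, M x ≠ x) {u w : V} (huw : u ≠ w) :
    ∃ ρ : Equiv.Perm V, (∀ x, ρ x ≠ x) ∧ ρ u = w ∧
      ∀ x, x ≠ u → x ≠ M.symm w → x ≠ w → ρ x = M x := by
  obtain ⟨p, rfl⟩ := M.surjective w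
  simp only [Equiv.symm_apply_apply]
  by_cases hp : M u = p
  · subst hp
    have hinj := M.injective
    have hMu := hM u
    have hMp := hM (M u)
    have hMw := hM (M (M u))
    have hne : M (M (M u)) ≠ M u := fun h => huw (hinj h).symm
    refine ⟨M * (Equiv.swap u (M (M u)) * Equiv.swap u (M u)), fun x => ?_, ?_, ?_⟩
    · simp only [Equiv.Perm.mul_apply, Equiv.swap_apply_def]
      grind
    · simp only [Equiv.Perm.mul_apply, Equiv.swap_apply_def]
      grind
    · intro x h1 h2 h3
      simp only [Equiv.Perm.mul_apply, Equiv.swap_apply_def]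
      grind
  · refine ⟨M * Equiv.swap u p, fun x => ?_, by simp, fun x h1 h2 _ => ?_⟩
    · have := hM x
      simp only [Equiv.Perm.mul_apply, Equiv.swap_apply_def]
      grind
    · simp [Equiv.swap_apply_of_ne_of_ne h1 h2]

/-- The edges of a derangement contribute at most the total of a nonnegative function
over all edges. -/
theorem sum_derangement_le_sum_edges {V : Type*} [Fintype V] [DecidableEq V]
    (F : V × V → ℝ) (hF : ∀ e : V × V, e.1 ≠ e.2 → 0 ≤ F e)
    (σ : Equiv.Perm V) (hσ : ∀ x, σ x ≠ x) :
    ∑ x, F (x, σ x) ≤ ∑ e ∈ univ.filter (fun p : V × V => p.1 ≠ p.2), F e := by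
  have hinj : Function.Injective fun x : V => (x, σ x) := fun a c h => congrArg Prod.fst h
  calc ∑ x, F (x, σ x) = ∑ e ∈ univ.image (fun x : V => (x, σ x)), F e :=
        (sum_image fun _ _ _ _ h => hinj h).symm
    _ ≤ _ := by
        refine sum_le_sum_of_subset_of_nonneg ?_ fun e he _ => hF e (mem_filter.1 he).2
        intro e he
        obtain ⟨x, -, rfl⟩ := mem_image.1 he
        simpa using (hσ x).symm

/-- If the edge `(u, w)` with bid `c` is not in an optimal derangement `τ` for the modified
bids, then `c` is bounded by the weight of the optimal `M`-edges that rerouting removes. -/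
theorem losing_bid_le {V : Type*} [Fintype V] [DecidableEq V]
    (b : V → V → ℝ) (hb : ∀ u w, u ≠ w → 0 ≤ b u w)
    (M : Equiv.Perm V) (hM : ∀ x, M x ≠ x)
    (hMopt : ∀ σ : Equiv.Perm V, (∀ x, σ x ≠ x) → ∑ x, b x (σ x) ≤ ∑ x, b x (M x))
    {u w : V} (huw : u ≠ w) (c : ℝ) (τ : Equiv.Perm V) (hτ : ∀ x, τ x ≠ x)
    (hτopt : ∀ σ : Equiv.Perm V, (∀ x, σ x ≠ x) →
      ∑ x, (if x = u ∧ σ x = w then c else b x (σ x)) ≤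
        ∑ x, (if x = u ∧ τ x = w then c else b x (τ x)))
    (hlose : τ u ≠ w) :
    c ≤ b u (M u) + b (M.symm w) w + b w (M w) := by
  obtain ⟨ρ, hρ, hρu, hρM⟩ := exists_derangement_through_edge M hM huw
  have hτb : ∑ x, (if x = u ∧ τ x = w then c else b x (τ x)) = ∑ x, b x (τ x) :=
    sum_congr rfl fun x _ => if_neg (by rintro ⟨rfl, h⟩; exact hlose h)
  have hpoint : ∑ x, (b x (M x) + if x = u then c else 0) ≤
      ∑ x, ((if x = u ∧ ρ x = w then c else b x (ρ x)) + (if x = u then b x (M x) else 0) +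
        (if x = M.symm w then b x (M x) else 0) + (if x = w then b x (M x) else 0)) := by
    refine sum_le_sum fun x _ => ?_
    have h1 := hb x (M x) (hM x).symm
    have h2 := hb x (ρ x) (hρ x).symm
    have h3 := hρM x
    split_ifs <;> grind
  simp only [sum_add_distrib, sum_ite_eq', mem_univ, if_true, Equiv.apply_symm_apply] at hpoint
  linarith [hτopt ρ hρ, hMopt τ hτ]

/-- **Lemma 5 of the paper.** The pay-your-bid mechanism computing an
optimal cycle cover is `(1/2, 3)`-smooth for deviations to half the value. Here `g` is
a selection rule picking, for each nonnegative bid function, a maximum-weight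
derangement; player `e = (e.1, e.2)` deviates to bidding `v(e)/2` on its edge. -/
theorem cycle_cover_mechanism_half_smooth
    {V : Type*} [Fintype V] [DecidableEq V] (hV : 2 ≤ Fintype.card V)
    (g : (V → V → ℝ) → Equiv.Perm V)
    (hgd : ∀ b : V → V → ℝ, (∀ u w, u ≠ w → 0 ≤ b u w) → ∀ x, g b x ≠ x)
    (hgopt : ∀ b : V → V → ℝ, (∀ u w, u ≠ w → 0 ≤ b u w) →
      ∀ σ : Equiv.Perm V, (∀ x, σ x ≠ x) → ∑ x, b x (g b x) ≥ ∑ x, b x (σ x))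
    (v b : V → V → ℝ) (hv : ∀ u w, u ≠ w → 0 ≤ v u w) (hb : ∀ u w, u ≠ w → 0 ≤ b u w) :
    ∑ e ∈ univ.filter (fun p : V × V => p.1 ≠ p.2),
        (v e.1 e.2 - v e.1 e.2 / 2) *
          (if g (fun x y => if x = e.1 ∧ y = e.2 then v e.1 e.2 / 2 else b x y) e.1 = e.2
            then (1 : ℝ) else 0)
      ≥ 1 / 2 * derW v
        - 3 * ∑ e ∈ univ.filter (fun p : V × V => p.1 ≠ p.2),
            b e.1 e.2 * (if g b e.1 = e.2 then (1 : ℝ) else 0) := by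
  have hM := hgd b hb
  have hopt := hgopt b hb
  set M := g b
  have hhalf : ∀ u w, u ≠ w → 0 ≤ v u w / 2 := fun u w h => by linarith [hv u w h]
  set B := ∑ e ∈ univ.filter (fun p : V × V => p.1 ≠ p.2),
    b e.1 e.2 * (if M e.1 = e.2 then (1 : ℝ) else 0)
  set L := ∑ e ∈ univ.filter (fun p : V × V => p.1 ≠ p.2),
    (v e.1 e.2 - v e.1 e.2 / 2) *
      (if g (fun x y => if x = e.1 ∧ y = e.2 then v e.1 e.2 / 2 else b x y) e.1 = e.2
        then (1 : ℝ) else 0) with hL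
  have hB : ∑ x, b x (M x) ≤ B := by
    have := sum_derangement_le_sum_edges
      (fun e => b e.1 e.2 * (if M e.1 = e.2 then (1 : ℝ) else 0))
      (fun e he => mul_nonneg (hb _ _ he) (by split_ifs <;> simp)) M hM
    simpa only [if_true, mul_one] using this
  suffices h : derW v ≤ 2 * (L + 3 * B) by linarith
  refine csSup_le ⟨_, M, hM, rfl⟩ ?_
  rintro _ ⟨σ, hσ, rfl⟩
  have hσL := sum_derangement_le_sum_edges
    (fun e => (v e.1 e.2 - v e.1 e.2 / 2) *
      (if g (fun x y => if x = e.1 ∧ y = e.2 then v e.1 e.2 / 2 else b x y) e.1 = e.2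
        then (1 : ℝ) else 0))
    (fun e he => mul_nonneg (by linarith [hhalf _ _ he]) (by split_ifs <;> simp)) σ hσ
  rw [← hL] at hσL
  have hpoint : ∀ u, v u (σ u) / 2 ≤ (v u (σ u) - v u (σ u) / 2) *
      (if g (fun x y => if x = u ∧ y = σ u then v u (σ u) / 2 else b x y) u = σ u
        then (1 : ℝ) else 0) +
      (b u (M u) + b (M.symm (σ u)) (σ u) + b (σ u) (M (σ u))) := by
    intro u
    have hne : u ≠ σ u := (hσ u).symm
    have hb' : ∀ x y, x ≠ y →
        0 ≤ (fun x y => if x = u ∧ y = σ u then v u (σ u) / 2 else b x y) x y := by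
      intro x y hxy
      dsimp only
      split_ifs
      exacts [hhalf _ _ hne, hb x y hxy]
    split_ifs with hwin
    · have h1 := hb u (M u) (hM u).symm
      have h2 := hb (M.symm (σ u)) (σ u) (by simpa using (hM (M.symm (σ u))).symm)
      have h3 := hb (σ u) (M (σ u)) (hM (σ u)).symm
      linarith
    · have := losing_bid_le b hb M hM hopt hne (v u (σ u) / 2) _ (hgd _ hb') (hgopt _ hb') hwin
      linarith
  have hsum := sum_le_sum fun u (_ : u ∈ univ) => hpoint u
  simp only [sum_add_distrib] at hsum
  have hpred : ∑ u, b (M.symm (σ u)) (σ u) = ∑ x, b x (M x) := by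
    rw [Equiv.sum_comp σ fun w => b (M.symm w) w, ← Equiv.sum_comp M]
    simp
  have hsucc : ∑ u, b (σ u) (M (σ u)) = ∑ x, b x (M x) := Equiv.sum_comp σ fun w => b w (M w)
  rw [hpred, hsucc, ← sum_div] at hsum
  linarith
end

section
/- Let V be a finite set with |V| ≥ 2, let σ be a derangement of V, and let w be a nonnegative weight function on ordered pairs of distinct elements of V. Then there exists a tour τ of V with ∑_{x∈V} w(x,τ(x)) ≥ (1/2)·∑_{x∈V} w(x,σ(x)). -/
open Finset

namespace Equiv.Perm

variable {V : Type*} [Finite V]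

theorem sameCycle_mul_swap [DecidableEq V] {τ : Perm V} {a b : V} (h : ¬ τ.SameCycle a b) :
    (τ * swap a b).SameCycle a b := by
  by_contra hb
  have key : ∀ j : ℕ, (τ * swap a b).SameCycle a ((τ ^ (j + 1)) b) := by
    intro j
    induction j with
    | zero => exact ⟨1, by simp⟩
    | succ j ih =>
      have hne_b : (τ ^ (j + 1)) b ≠ b := fun he => hb (by rwa [he] at ih)
      have hne_a : (τ ^ (j + 1)) b ≠ a := fun he =>
        h (SameCycle.symm ⟨((j + 1 : ℕ) : ℤ), by rw [zpow_natCast]; exact he⟩)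
      have step : (τ * swap a b) ((τ ^ (j + 1)) b) = (τ ^ (j + 1 + 1)) b := by
        rw [mul_apply, swap_apply_of_ne_of_ne hne_a hne_b, pow_succ' τ (j + 1), mul_apply]
      rw [← step]
      exact sameCycle_apply_right.2 ih
  have := key (orderOf τ - 1)
  rw [Nat.sub_add_cancel (orderOf_pos τ), pow_orderOf_eq_one] at this
  exact hb this

theorem SameCycle.of_forall_apply {σ τ : Perm V} (h : ∀ x, τ.SameCycle x (σ x)) {x y : V}
    (hxy : σ.SameCycle x y) : τ.SameCycle x y := by
  obtain ⟨n, rfl⟩ := hxy.exists_nat_pow_eq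
  clear hxy
  induction n with
  | zero => exact SameCycle.refl _ _
  | succ n ih =>
    rw [pow_succ', mul_apply]
    exact ih.trans (h _)

theorem SameCycle.mul_swap [DecidableEq V] {τ : Perm V} {a b x y : V}
    (h : ¬ τ.SameCycle a b) (hxy : τ.SameCycle x y) : (τ * swap a b).SameCycle x y := by
  have hab := sameCycle_mul_swap h
  refine SameCycle.of_forall_apply (fun z => ?_) hxy
  by_cases hza : z = a
  · subst hza
    exact hab.trans ⟨1, by simp⟩
  by_cases hzb : z = b
  · subst hzb
    exact hab.symm.trans ⟨1, by simp⟩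
  · exact ⟨1, by simp [swap_apply_of_ne_of_ne hza hzb]⟩

/-- The cycles of `σ` through `S` can be merged by only redirecting the arcs leaving `S`. -/
theorem exists_merge_cycles (σ : Perm V) (S : Finset V) :
    ∃ τ : Perm V, (∀ x ∉ S, τ x = σ x) ∧ (∀ x y, σ.SameCycle x y → τ.SameCycle x y) ∧
      ∀ x ∈ S, ∀ y ∈ S, τ.SameCycle x y := by
  classical
  induction S using Finset.induction_on with
  | empty => exact ⟨σ, by simp⟩
  | insert b S hb ih =>
    obtain ⟨τ, hτ, hmono, hS⟩ := ih
    obtain rfl | ⟨a, ha⟩ := S.eq_empty_or_nonempty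
    · exact ⟨σ, by simp [SameCycle.refl]⟩
    have join {ρ : Perm V} (hρ : ∀ x ∈ S, ∀ y ∈ S, ρ.SameCycle x y) (hab : ρ.SameCycle a b) :
        ∀ x ∈ insert b S, ∀ y ∈ insert b S, ρ.SameCycle x y := by
      have hall : ∀ x ∈ insert b S, ρ.SameCycle a x := fun x hx => by
        obtain rfl | hx := Finset.mem_insert.1 hx
        exacts [hab, hρ a ha x hx]
      exact fun x hx y hy => (hall x hx).symm.trans (hall y hy)
    by_cases hab : τ.SameCycle a b
    · exact ⟨τ, fun x hx => hτ x fun h => hx (Finset.mem_insert_of_mem h), hmono, join hS hab⟩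
    · refine ⟨τ * swap a b, fun x hx => ?_, fun x y hxy => (hmono x y hxy).mul_swap hab,
        join (fun x hx y hy => (hS x hx y hy).mul_swap hab) (sameCycle_mul_swap hab)⟩
      rw [Finset.mem_insert, not_or] at hx
      have hxa : x ≠ a := fun h => hx.2 (h ▸ ha)
      rw [mul_apply, swap_apply_of_ne_of_ne hxa hx.1, hτ x hx.2]

/-- A set meeting every cycle of a derangement can carry at most half of a nonnegative weight. -/
theorem exists_cycle_transversal_sum_le {V : Type*} [Fintype V] (σ : Perm V) (hσ : ∀ x, σ x ≠ x)
    (f : V → ℝ) (hf : ∀ x, 0 ≤ f x) :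
    ∃ B : Finset V, (∀ x, ∃ b ∈ B, σ.SameCycle x b) ∧ 2 * ∑ x ∈ B, f x ≤ ∑ x, f x := by
  classical
  have hmin : ∀ q : Quotient (SameCycle.setoid σ), ∃ m : V, ⟦m⟧ = q ∧
      ∀ y, (⟦y⟧ : Quotient (SameCycle.setoid σ)) = q → f m ≤ f y := by
    intro q
    obtain ⟨m, hm, hle⟩ := Finset.exists_min_image
      {y : V | (⟦y⟧ : Quotient (SameCycle.setoid σ)) = q} f
      (by obtain ⟨x, rfl⟩ := q.exists_rep; exact ⟨x, by simp⟩)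
    exact ⟨m, by simpa using hm, fun y hy => hle y (by simpa using hy)⟩
  choose m hm hle using hmin
  have hclass (x : V) : (⟦σ x⟧ : Quotient (SameCycle.setoid σ)) = ⟦x⟧ :=
    Quotient.sound (sameCycle_apply_left.2 (SameCycle.refl σ x))
  let B : Finset V := {x | m ⟦x⟧ = x}
  have hB {x : V} : x ∈ B ↔ m ⟦x⟧ = x := by simp [B]
  refine ⟨B, fun x => ⟨m ⟦x⟧, hB.2 (by rw [hm]), Quotient.exact (hm ⟦x⟧).symm⟩, ?_⟩
  have hdisj : _root_.Disjoint B (B.map σ.toEmbedding) := by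
    rw [Finset.disjoint_left]
    intro y hy hy'
    obtain ⟨x, hx, rfl⟩ := Finset.mem_map.1 hy'
    rw [Equiv.coe_toEmbedding, hB, hclass, hB.1 hx] at hy
    exact hσ x hy.symm
  calc 2 * ∑ x ∈ B, f x = ∑ x ∈ B, f x + ∑ x ∈ B, f x := two_mul _
    _ ≤ ∑ x ∈ B, f x + ∑ x ∈ B, f (σ x) := by
      gcongr with x hx
      have := hle ⟦x⟧ (σ x) (hclass x)
      rwa [hB.1 hx] at this
    _ = ∑ x ∈ B ∪ B.map σ.toEmbedding, f x := by
      rw [Finset.sum_union hdisj, Finset.sum_map]; rfl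
    _ ≤ ∑ x, f x := Finset.sum_le_univ_sum_of_nonneg hf

end Equiv.Perm

/-- **approximation guarantee of Fisher's algorithm.** For every
derangement (cycle cover) `σ` of a finite set `V` with `|V| ≥ 2` and every nonnegative
weight function `w`, there is a tour (a single cycle on all of `V`) whose weight is at
least half the weight of `σ`. -/
theorem tour_from_cycle_cover_half_weight
    {V : Type*} [Fintype V] [DecidableEq V] (hV : 2 ≤ Fintype.card V)
    (σ : Equiv.Perm V) (hσ : ∀ x, σ x ≠ x)
    (w : V → V → ℝ) (hw : ∀ u y, u ≠ y → 0 ≤ w u y) :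
    ∃ τ : Equiv.Perm V, τ.IsCycle ∧ τ.support = univ ∧
      ∑ x, w x (τ x) ≥ 1 / 2 * ∑ x, w x (σ x) := by
  obtain ⟨B, hB, hsum⟩ := σ.exists_cycle_transversal_sum_le hσ (fun x => w x (σ x))
    fun x => hw _ _ (hσ x).symm
  obtain ⟨τ, hτ, hmono, hjoin⟩ := σ.exists_merge_cycles B
  have hall (x y : V) : τ.SameCycle x y := by
    obtain ⟨b, hb, hxb⟩ := hB x
    obtain ⟨c, hc, hyc⟩ := hB y
    exact ((hmono _ _ hxb).trans (hjoin b hb c hc)).trans (hmono _ _ hyc).symm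
  have : Nontrivial V := Fintype.one_lt_card_iff_nontrivial.1 hV
  have hfix (x : V) : τ x ≠ x := fun h => by
    obtain ⟨y, hy⟩ := exists_ne x
    exact hy ((hall x y).eq_of_left h).symm
  obtain ⟨x₀⟩ : Nonempty V := inferInstance
  refine ⟨τ, ⟨x₀, hfix x₀, fun y _ => hall x₀ y⟩, by ext; simp [hfix], ?_⟩
  have hτB : 0 ≤ ∑ x ∈ B, w x (τ x) := Finset.sum_nonneg fun x _ => hw _ _ (hfix x).symm
  have hcompl : ∑ x ∈ Bᶜ, w x (τ x) = ∑ x ∈ Bᶜ, w x (σ x) :=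
    Finset.sum_congr rfl fun x hx => by rw [hτ x (Finset.mem_compl.1 hx)]
  have hsplit_τ := Finset.sum_add_sum_compl B fun x => w x (τ x)
  have hsplit_σ := Finset.sum_add_sum_compl B fun x => w x (σ x)
  linarith
end

section
/- Suppose r assigns to each derangement σ of V a finitely-supported probability distribution r(σ) on tours of V such that for every x ∈ V, Pr_{τ∼r(σ)}[τ(x)=σ(x)] ≥ 1/2. Consider the randomized pay-your-bid mechanism that, on nonnegative bids b, computes a derangement ĝ(b) of maximum weight under b and outputs a tour τ ∼ r(ĝ(b)). Let v be nonnegative valuations and let b be a pure Nash equilibrium of the expected-utility game under v (no player e can increase U_e by unilaterally changing its bid to any nonnegative value) at which U_e(b) ≥ 0 for every player e. Then the expected welfare satisfies E_{τ∼r(ĝ(b))}[∑_{x∈V} v(x,τ(x))] ≥ (1/12)·max over tours τ' of ∑_{x∈V} v(x,τ'(x)). -/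
open Finset

/-- Any edge `(x, y)` can be inserted in a derangement `σ` by changing only the images of
`x`, `σ⁻¹ y` and `y`. -/
theorem exists_derangement_through_edge_s15 {V : Type*} [DecidableEq V] {σ : Equiv.Perm V}
    (hσ : ∀ x, σ x ≠ x) {x y : V} (hxy : x ≠ y) :
    ∃ π : Equiv.Perm V, (∀ z, π z ≠ z) ∧ π x = y ∧
      ∀ z, z ≠ x → z ≠ σ.symm y → z ≠ y → π z = σ z := by
  obtain ⟨c, rfl⟩ := σ.surjective y
  simp only [Equiv.symm_apply_apply]
  by_cases hc : σ x = c
  · have hxc : x ≠ c := fun h => hσ x (hc.trans h.symm)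
    have hcy : c ≠ σ c := (hσ c).symm
    refine ⟨σ * (Equiv.swap x c * Equiv.swap c (σ c)), fun z => ?_, ?_, fun z h1 h2 h3 => ?_⟩
    · by_cases h1 : z = x
      · subst h1
        simp [Equiv.swap_apply_of_ne_of_ne hxc hxy, hxy.symm]
      by_cases h2 : z = c
      · subst h2
        have : σ (σ z) ≠ z := fun h => hxy (σ.injective (hc.trans h.symm))
        simpa [Equiv.swap_apply_of_ne_of_ne hxy.symm hcy.symm] using this
      by_cases h3 : z = σ c
      · subst h3
        simpa [hc] using hcy
      · simpa [Equiv.swap_apply_of_ne_of_ne h2 h3, Equiv.swap_apply_of_ne_of_ne h1 h2]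
          using hσ z
    · simp [Equiv.swap_apply_of_ne_of_ne hxc hxy]
    · simp [Equiv.swap_apply_of_ne_of_ne h2 h3, Equiv.swap_apply_of_ne_of_ne h1 h2]
  · refine ⟨σ * Equiv.swap x c, fun z => ?_, by simp, fun z h1 h2 _ => ?_⟩
    · by_cases h1 : z = x
      · subst h1
        simpa using hxy.symm
      by_cases h2 : z = c
      · subst h2
        simpa using hc
      · simpa [Equiv.swap_apply_of_ne_of_ne h1 h2] using hσ z
    · simp [Equiv.swap_apply_of_ne_of_ne h1 h2]

/-- If `σ` is a maximum-weight derangement under `b`, then raising the bid of `(x, y)` above the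
total bid of the edges of `σ` leaving `x`, entering `y` and leaving `y` forces `(x, y)` into
every maximum-weight derangement. -/
theorem edge_mem_of_critical_bid_lt {V : Type*} [Fintype V] [DecidableEq V]
    {b : V → V → ℝ} (hb : ∀ u w, u ≠ w → 0 ≤ b u w) {σ ρ : Equiv.Perm V}
    (hσ : ∀ x, σ x ≠ x) (hρ : ∀ x, ρ x ≠ x)
    (hσopt : ∀ π : Equiv.Perm V, (∀ x, π x ≠ x) → ∑ x, b x (π x) ≤ ∑ x, b x (σ x))
    {x y : V} (hxy : x ≠ y) {s : ℝ}
    (hs : b x (σ x) + b (σ.symm y) y + b y (σ y) < s)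
    (hρopt : ∀ π : Equiv.Perm V, (∀ z, π z ≠ z) →
      ∑ z, (if z = x ∧ π z = y then s else b z (π z)) ≤
        ∑ z, (if z = x ∧ ρ z = y then s else b z (ρ z))) :
    ρ x = y := by
  by_contra hne
  obtain ⟨π, hπ, hπx, hπσ⟩ := exists_derangement_through_edge_s15 hσ hxy
  have h1 : ∑ z, (if z = x ∧ ρ z = y then s else b z (ρ z)) = ∑ z, b z (ρ z) := by
    refine sum_congr rfl fun z _ => if_neg ?_
    rintro ⟨rfl, h⟩
    exact hne h
  have h2 : ∑ z, b z (σ z) ≤ ∑ z, ((if z = x ∧ π z = y then s else b z (π z))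
      + (if z = x then b x (σ x) - s else 0)
      + (if z = σ.symm y then b (σ.symm y) y else 0) + (if z = y then b y (σ y) else 0)) := by
    refine sum_le_sum fun z _ => ?_
    have hc : 0 ≤ b (σ.symm y) y := hb _ _ fun h => hσ (σ.symm y) (by simpa using h.symm)
    have hy : 0 ≤ b y (σ y) := hb _ _ (hσ y).symm
    have hz : 0 ≤ b z (π z) := hb _ _ (hπ z).symm
    by_cases hzx : z = x
    · subst hzx
      simp only [hπx, and_self, if_true]
      split_ifs <;> linarith
    · simp only [hzx, false_and, if_false]
      by_cases hzc : z = σ.symm y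
      · have : σ z = y := by simp [hzc]
        rw [this, if_pos hzc, ← hzc]
        split_ifs <;> linarith
      · by_cases hzy : z = y
        · subst hzy
          simp only [if_true, if_neg hzc]
          linarith
        · simp [hπσ z hzx hzc hzy, hzc, hzy]
  simp only [sum_add_distrib, sum_ite_eq', mem_univ, if_true] at h2
  have h3 := hρopt π hπ
  have h4 := hσopt ρ hρ
  linarith

/-- The expected weight of a random permutation in terms of its edge probabilities. -/
theorem sum_mul_sum_apply_eq_sum_edges {V : Type*} [Fintype V] [DecidableEq V]
    (p : Equiv.Perm V → ℝ) (w : V → V → ℝ) :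
    ∑ τ, p τ * ∑ x, w x (τ x) =
      ∑ x, ∑ y, w x y * ∑ τ ∈ univ.filter (fun τ : Equiv.Perm V => τ x = y), p τ := by
  simp only [mul_sum, sum_filter]
  rw [sum_comm]
  refine sum_congr rfl fun x _ => ?_
  rw [sum_comm]
  refine sum_congr rfl fun τ _ => ?_
  simp [mul_comm]



/-- **max-TSP Price of Anarchy.** Suppose `r` rounds every cycle cover
(derangement) `σ` of `V` to a distribution on tours in which every edge of `σ` survives
with probability at least `1/2`, and `g` picks a maximum-weight derangement for each
nonnegative bid function. Then at every pure Nash equilibrium of the expected-utility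
game of the randomized pay-your-bid mechanism with nonnegative utilities, the expected
welfare is at least `1/12` of the maximum welfare of a tour. -/
theorem max_tsp_relax_and_round_poa
    {V : Type*} [Fintype V] [DecidableEq V] (hV : 2 ≤ Fintype.card V)
    (r : Equiv.Perm V → Equiv.Perm V → ℝ)
    (hr0 : ∀ σ : Equiv.Perm V, (∀ x, σ x ≠ x) → ∀ τ, 0 ≤ r σ τ)
    (hr1 : ∀ σ : Equiv.Perm V, (∀ x, σ x ≠ x) → ∑ τ, r σ τ = 1)
    (hrsupp : ∀ σ : Equiv.Perm V, (∀ x, σ x ≠ x) → ∀ τ : Equiv.Perm V, r σ τ ≠ 0 →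
      τ.IsCycle ∧ τ.support = univ)
    (hrmarg : ∀ σ : Equiv.Perm V, (∀ x, σ x ≠ x) → ∀ x : V,
      ∑ τ ∈ univ.filter (fun τ : Equiv.Perm V => τ x = σ x), r σ τ ≥ 1 / 2)
    (g : (V → V → ℝ) → Equiv.Perm V)
    (hgd : ∀ b : V → V → ℝ, (∀ u w, u ≠ w → 0 ≤ b u w) → ∀ x, g b x ≠ x)
    (hgopt : ∀ b : V → V → ℝ, (∀ u w, u ≠ w → 0 ≤ b u w) →
      ∀ σ : Equiv.Perm V, (∀ x, σ x ≠ x) → ∑ x, b x (g b x) ≥ ∑ x, b x (σ x))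
    (v b : V → V → ℝ) (hv : ∀ u w, u ≠ w → 0 ≤ v u w) (hb : ∀ u w, u ≠ w → 0 ≤ b u w)
    (hNash : ∀ e : V × V, e.1 ≠ e.2 → ∀ r' : ℝ, 0 ≤ r' →
      (v e.1 e.2 - b e.1 e.2) *
          ∑ τ ∈ univ.filter (fun τ : Equiv.Perm V => τ e.1 = e.2), r (g b) τ
        ≥ (v e.1 e.2 - r') *
          ∑ τ ∈ univ.filter (fun τ : Equiv.Perm V => τ e.1 = e.2),
            r (g (fun x y => if x = e.1 ∧ y = e.2 then r' else b x y)) τ)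
    (hIR : ∀ e : V × V, e.1 ≠ e.2 →
      0 ≤ (v e.1 e.2 - b e.1 e.2) *
          ∑ τ ∈ univ.filter (fun τ : Equiv.Perm V => τ e.1 = e.2), r (g b) τ) :
    ∑ τ : Equiv.Perm V, r (g b) τ * ∑ x, v x (τ x)
      ≥ 1 / 12 * sSup {w : ℝ | ∃ τ' : Equiv.Perm V,
          τ'.IsCycle ∧ τ'.support = univ ∧ w = ∑ x, v x (τ' x)} := by
  set σ := g b with hσdef
  have hσ : ∀ x, σ x ≠ x := hgd b hb
  set q : V → V → ℝ := fun x y =>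
    ∑ τ ∈ univ.filter (fun τ : Equiv.Perm V => τ x = y), r σ τ with hq
  have hq0 : ∀ x y, 0 ≤ q x y := fun x y => sum_nonneg fun τ _ => hr0 σ hσ τ
  have hqd : ∀ x, q x x = 0 := by
    intro x
    refine sum_eq_zero fun τ hτ => ?_
    by_contra h
    have hx : x ∈ τ.support := (hrsupp σ hσ τ h).2 ▸ mem_univ x
    exact Equiv.Perm.mem_support.mp hx (mem_filter.mp hτ).2
  have hU0 : ∀ x y, 0 ≤ (v x y - b x y) * q x y := by
    intro x y
    by_cases hxy : x = y
    · subst hxy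
      simp [hqd]
    · exact hIR (x, y) hxy
  have hbq0 : ∀ x y, 0 ≤ b x y * q x y := by
    intro x y
    by_cases hxy : x = y
    · subst hxy
      simp [hqd]
    · exact mul_nonneg (hb x y hxy) (hq0 x y)
  have hdev : ∀ x y, x ≠ y →
      (v x y - (b x (σ x) + b (σ.symm y) y + b y (σ y))) / 2 ≤ (v x y - b x y) * q x y := by
    intro x y hxy
    set t := b x (σ x) + b (σ.symm y) y + b y (σ y) with ht
    have ht0 : 0 ≤ t := by
      have h1 := hb _ _ (hσ x).symm
      have h2 := hb (σ.symm y) y fun h => hσ (σ.symm y) (by simpa using h.symm)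
      have h3 := hb _ _ (hσ y).symm
      linarith
    refine le_of_forall_pos_le_add fun ε hε => ?_
    have hs0 : 0 ≤ t + ε := by linarith
    have hb' : ∀ u w, u ≠ w → 0 ≤ (fun u w => if u = x ∧ w = y then t + ε else b u w) u w := by
      intro u w huw
      dsimp only
      split_ifs
      · exact hs0
      · exact hb u w huw
    have hmem := edge_mem_of_critical_bid_lt hb hσ (hgd _ hb') (hgopt b hb) hxy
      (lt_add_of_pos_right t hε) (hgopt _ hb')
    have hhalf := hrmarg _ (hgd _ hb') x
    rw [hmem] at hhalf
    have hN := hNash (x, y) hxy (t + ε) hs0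
    dsimp only at hN
    rcases le_total (t + ε) (v x y) with h | h
    · have := mul_le_mul_of_nonneg_left hhalf (sub_nonneg.mpr h)
      linarith
    · have := hU0 x y
      linarith
  have hwelfare : ∑ τ, r σ τ * ∑ x, v x (τ x) =
      ∑ x, ∑ y, (v x y - b x y) * q x y + ∑ x, ∑ y, b x y * q x y := by
    rw [sum_mul_sum_apply_eq_sum_edges]
    simp only [← sum_add_distrib, hq]
    exact sum_congr rfl fun x _ => sum_congr rfl fun y _ => by ring
  have hpay : (∑ x, b x (σ x)) / 2 ≤ ∑ x, ∑ y, b x y * q x y := by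
    rw [sum_div]
    refine sum_le_sum fun x _ => ?_
    have h1 := single_le_sum (fun y _ => hbq0 x y) (mem_univ (σ x))
    have h2 := mul_le_mul_of_nonneg_left (hrmarg σ hσ x) (hb _ _ (hσ x).symm)
    linarith
  have hUsum : 0 ≤ ∑ x, ∑ y, (v x y - b x y) * q x y :=
    sum_nonneg fun x _ => sum_nonneg fun y _ => hU0 x y
  have hPsum : 0 ≤ ∑ x, ∑ y, b x y * q x y :=
    sum_nonneg fun x _ => sum_nonneg fun y _ => hbq0 x y
  suffices h : sSup {w : ℝ | ∃ τ' : Equiv.Perm V,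
      τ'.IsCycle ∧ τ'.support = univ ∧ w = ∑ x, v x (τ' x)} ≤
      12 * ∑ τ, r σ τ * ∑ x, v x (τ x) by linarith
  refine Real.sSup_le ?_ (by linarith)
  rintro w ⟨π, -, hπ, rfl⟩
  have hπd : ∀ x, x ≠ π x := fun x =>
    (Equiv.Perm.mem_support.mp (hπ ▸ mem_univ x : x ∈ π.support)).symm
  have hsum : ∑ x, (v x (π x) - (b x (σ x) + b (σ.symm (π x)) (π x) + b (π x) (σ (π x)))) / 2 ≤
      ∑ x, ∑ y, (v x y - b x y) * q x y :=
    sum_le_sum fun x _ => (hdev x (π x) (hπd x)).trans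
      (single_le_sum (fun y _ => hU0 x y) (mem_univ (π x)))
  have hin : ∑ x, b (σ.symm (π x)) (π x) = ∑ x, b x (σ x) := by
    rw [← Equiv.sum_comp (π.trans σ.symm) fun x => b x (σ x)]
    simp
  have hout : ∑ x, b (π x) (σ (π x)) = ∑ x, b x (σ x) :=
    Equiv.sum_comp π fun x => b x (σ x)
  rw [← sum_div, sum_sub_distrib, sum_add_distrib, sum_add_distrib, hin, hout] at hsum
  linarith
end

section
/- The pay-your-bid mechanism that solves the configuration LP exactly is (1/2, k+1)-smooth for deviations to half the value on MPH-k valuations and bids: for every profile v of MPH-k valuations and every profile b of MPH-k bids, with deviations b'_i = (1/2)·v_i (which are again MPH-k), ∑_{i∈N} ∑_{S⊆[m]} (v_i(S) − b'_i(S))·x̂(b'_i,b_{-i})_{i,S} ≥ (1/2)·W^{v}(1) − (k+1)·∑_{i∈N} ∑_{S⊆[m]} b_i(S)·x̂(b)_{i,S}. -/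
open Finset

/-- A function `v` on bundles of the `m` items is MPH-`k` (maximum over positive
hypergraphs of rank `k`) if it is the maximum, over a nonempty finite index set, of sums
of nonnegative weights on nonempty bundles of at most `k` items. -/
def IsMPH (m k : ℕ) (v : Finset (Fin m) → ℝ) : Prop :=
  ∃ (n : ℕ) (w : Fin (n + 1) → Finset (Fin m) → ℝ),
    (∀ ℓ T, 0 ≤ w ℓ T) ∧
    ∀ S : Finset (Fin m), v S = univ.sup' univ_nonempty
      (fun ℓ => ∑ T ∈ S.powerset.filter (fun T => 1 ≤ T.card ∧ T.card ≤ k), w ℓ T)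

/-- A fractional allocation of the configuration LP, feasible for item capacities `q`. -/
def CAFeasible {N : Type*} [Fintype N] (m : ℕ) (q : Fin m → ℝ)
    (x : N → Finset (Fin m) → ℝ) : Prop :=
  (∀ i S, 0 ≤ x i S) ∧ (∀ i, ∑ S, x i S ≤ 1) ∧
    ∀ j : Fin m, ∑ i, ∑ S ∈ univ.filter (fun S : Finset (Fin m) => j ∈ S), x i S ≤ q j

/-- `caW m b q` is the optimal declared welfare `W^b(q)` of the configuration LP. -/
noncomputable def caW {N : Type*} [Fintype N] (m : ℕ) (b : N → Finset (Fin m) → ℝ)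
    (q : Fin m → ℝ) : ℝ :=
  sSup {w : ℝ | ∃ x : N → Finset (Fin m) → ℝ, CAFeasible m q x ∧
    w = ∑ i, ∑ S, b i S * x i S}

/-- The value of an MPH function is nonnegative. -/
theorem IsMPH.nonneg {m k : ℕ} {v : Finset (Fin m) → ℝ} (hv : IsMPH m k v)
    (S : Finset (Fin m)) : 0 ≤ v S := by
  obtain ⟨n, w, hw, h⟩ := hv
  rw [h, Finset.le_sup'_iff]
  exact ⟨0, Finset.mem_univ 0, Finset.sum_nonneg fun T _ => hw 0 T⟩

theorem IsMPH.half {m k : ℕ} {v : Finset (Fin m) → ℝ} (hv : IsMPH m k v) :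
    IsMPH m k (fun S => v S / 2) := by
  obtain ⟨n, w, hw, h⟩ := hv
  refine ⟨n, fun ℓ T => w ℓ T / 2, fun ℓ T => div_nonneg (hw ℓ T) two_pos.le, fun S => ?_⟩
  simp only [h, ← Finset.sum_div]
  exact Finset.apply_sup'_eq_sup'_comp univ_nonempty (fun a : ℝ => a / 2)
    fun a b => (max_div_div_right two_pos.le a b).symm

/-- Removing items from a bundle costs at most the sum of nonnegative item prices whose total is at most
`k` times the value of the bundle. -/
theorem IsMPH.exists_prices {m k : ℕ} {v : Finset (Fin m) → ℝ} (hv : IsMPH m k v)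
    (S : Finset (Fin m)) :
    ∃ c : Fin m → ℝ, (∀ j, 0 ≤ c j) ∧ ∑ j, c j ≤ k * v S ∧ ∀ R, v S - ∑ j ∈ R, c j ≤ v (S \ R) := by
  obtain ⟨n, w, hw, h⟩ := hv
  obtain ⟨ℓ, -, hℓ⟩ := Finset.exists_mem_eq_sup' (univ_nonempty (α := Fin (n + 1)))
    (fun ℓ => ∑ T ∈ S.powerset.filter (fun T : Finset (Fin m) => 1 ≤ T.card ∧ T.card ≤ k), w ℓ T)
  rw [← h] at hℓ
  refine ⟨fun j => ∑ T ∈ S.powerset.filter (fun T : Finset (Fin m) => 1 ≤ T.card ∧ T.card ≤ k),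
    if j ∈ T then w ℓ T else 0, fun j => Finset.sum_nonneg fun T _ => ?_, ?_, fun R => ?_⟩
  · split_ifs
    exacts [hw ℓ T, le_rfl]
  · rw [Finset.sum_comm, hℓ, Finset.mul_sum]
    refine Finset.sum_le_sum fun T hT => ?_
    rw [← Finset.sum_filter, Finset.sum_const, nsmul_eq_mul, Finset.filter_univ_mem]
    exact mul_le_mul_of_nonneg_right (by exact_mod_cast (Finset.mem_filter.1 hT).2.2) (hw ℓ T)
  · have hle : ∑ T ∈ (S \ R).powerset.filter (fun T : Finset (Fin m) => 1 ≤ T.card ∧ T.card ≤ k), w ℓ T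
        ≤ v (S \ R) := by
      rw [h (S \ R), Finset.le_sup'_iff]
      exact ⟨ℓ, Finset.mem_univ ℓ, le_rfl⟩
    refine le_trans ?_ hle
    have hsub : (S \ R).powerset.filter (fun T : Finset (Fin m) => 1 ≤ T.card ∧ T.card ≤ k) =
        (S.powerset.filter (fun T : Finset (Fin m) => 1 ≤ T.card ∧ T.card ≤ k)).filter
          (fun T => Disjoint T R) := by
      ext T
      simp only [Finset.mem_filter, Finset.mem_powerset, Finset.subset_sdiff]
      tauto
    rw [hℓ, Finset.sum_comm, hsub, Finset.sum_filter (fun T => Disjoint T R),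
      sub_le_iff_le_add, ← Finset.sum_add_distrib]
    refine Finset.sum_le_sum fun T _ => ?_
    have hterm : ∀ j ∈ R, 0 ≤ if j ∈ T then w ℓ T else 0 := fun j _ => by
      split_ifs
      exacts [hw ℓ T, le_rfl]
    by_cases hd : Disjoint T R
    · simpa [hd] using Finset.sum_nonneg hterm
    · obtain ⟨j, hjT, hjR⟩ := Finset.not_disjoint_iff.1 hd
      have := Finset.single_le_sum hterm hjR
      simpa [hd, hjT] using this

/-- The fractional assignment of bundles obtained from `z` by removing from each bundle
a bundle drawn independently according to `p`. -/
def removeBundle {m : ℕ} (z p : Finset (Fin m) → ℝ) (A : Finset (Fin m)) : ℝ :=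
  ∑ S, ∑ R, if S \ R = A then z S * p R else 0

theorem sum_mul_removeBundle {m : ℕ} (z p f : Finset (Fin m) → ℝ) :
    ∑ A, f A * removeBundle z p A = ∑ S, z S * ∑ R, p R * f (S \ R) := by
  simp only [removeBundle, Finset.mul_sum]
  rw [Finset.sum_comm]
  refine Finset.sum_congr rfl fun S _ => ?_
  rw [Finset.sum_comm]
  refine Finset.sum_congr rfl fun R _ => ?_
  simp only [mul_ite, mul_zero, Finset.sum_ite_eq, Finset.mem_univ, if_true]
  ring

theorem sum_removeBundle {m : ℕ} {z p : Finset (Fin m) → ℝ} (hp : ∑ R, p R = 1) :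
    ∑ A, removeBundle z p A = ∑ S, z S := by
  simpa [hp] using sum_mul_removeBundle z p fun _ => 1

theorem removeBundle_nonneg {m : ℕ} {z p : Finset (Fin m) → ℝ} (hz : ∀ S, 0 ≤ z S)
    (hp : ∀ R, 0 ≤ p R) (A : Finset (Fin m)) : 0 ≤ removeBundle z p A := by
  refine Finset.sum_nonneg fun S _ => Finset.sum_nonneg fun R _ => ?_
  split_ifs
  exacts [mul_nonneg (hz S) (hp R), le_rfl]

theorem sum_mem_removeBundle {m : ℕ} {z p : Finset (Fin m) → ℝ} (hp : ∑ R, p R = 1)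
    (j : Fin m) :
    ∑ A ∈ univ.filter (fun A : Finset (Fin m) => j ∈ A), removeBundle z p A =
      (∑ S ∈ univ.filter (fun S : Finset (Fin m) => j ∈ S), z S) *
        (1 - ∑ R ∈ univ.filter (fun R : Finset (Fin m) => j ∈ R), p R) := by
  have h := sum_mul_removeBundle z p fun A => if j ∈ A then 1 else 0
  simp only [ite_mul, one_mul, zero_mul] at h
  rw [Finset.sum_filter, h, Finset.sum_filter, Finset.sum_mul]
  refine Finset.sum_congr rfl fun S _ => ?_
  by_cases hS : j ∈ S
  · simp only [hS, if_true, Finset.mem_sdiff, true_and, mul_ite, mul_one, mul_zero]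
    rw [← hp, Finset.sum_filter, ← Finset.sum_sub_distrib]
    congr 1
    refine Finset.sum_congr rfl fun R _ => ?_
    by_cases hR : j ∈ R <;> simp [hR]
  · simp [hS]

/-- Bidder `i` receives its share of `x`, and the others keep what remains of `z`. -/
theorem CAFeasible.update_removeBundle {N : Type*} [Fintype N] [DecidableEq N] {m : ℕ}
    {x z : N → Finset (Fin m) → ℝ} (hx : CAFeasible m (fun _ => 1) x)
    (hz : CAFeasible m (fun _ => 1) z) (i : N) (hxi : ∑ S, x i S = 1) :
    CAFeasible m (fun _ => 1)
      (Function.update (fun l => removeBundle (z l) (x i)) i (x i)) := by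
  have hnn : ∀ j l, 0 ≤ ∑ S ∈ univ.filter (fun S : Finset (Fin m) => j ∈ S), x l S :=
    fun j l => Finset.sum_nonneg fun S _ => hx.1 l S
  have hzn : ∀ j l, 0 ≤ ∑ S ∈ univ.filter (fun S : Finset (Fin m) => j ∈ S), z l S :=
    fun j l => Finset.sum_nonneg fun S _ => hz.1 l S
  refine ⟨fun l S => ?_, fun l => ?_, fun j => ?_⟩
  · rcases eq_or_ne l i with rfl | h
    · simpa using hx.1 l S
    · simpa [h] using removeBundle_nonneg (hz.1 l) (hx.1 i) S
  · rcases eq_or_ne l i with rfl | h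
    · simpa using hx.2.1 l
    · simpa [h, sum_removeBundle hxi] using hz.2.1 l
  · have hq := (Finset.single_le_sum (fun l _ => hnn j l) (Finset.mem_univ i)).trans (hx.2.2 j)
    have herase := (Finset.sum_le_sum_of_subset_of_nonneg (Finset.erase_subset i univ)
      fun l _ _ => hzn j l).trans (hz.2.2 j)
    rw [← Finset.add_sum_erase _ _ (Finset.mem_univ i), Finset.sum_congr rfl
      (g := fun l => (∑ S ∈ univ.filter (fun S : Finset (Fin m) => j ∈ S), z l S) *
        (1 - ∑ R ∈ univ.filter (fun R : Finset (Fin m) => j ∈ R), x i R))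
      fun l hl => by
        rw [Function.update_of_ne (Finset.ne_of_mem_erase hl), sum_mem_removeBundle hxi],
      Function.update_self, ← Finset.sum_mul]
    have := mul_le_mul_of_nonneg_right herase (sub_nonneg.2 hq)
    linarith

/-- Every feasible allocation is dominated by one giving each bidder exactly one bundle. -/
theorem CAFeasible.exists_complete {N : Type*} [Fintype N] {m : ℕ} {q : Fin m → ℝ}
    {x : N → Finset (Fin m) → ℝ} (hx : CAFeasible m q x) :
    ∃ x', CAFeasible m q x' ∧ (∀ i, ∑ S, x' i S = 1) ∧ ∀ i S, x i S ≤ x' i S := by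
  have hr : ∀ i, 0 ≤ 1 - ∑ R, x i R := fun i => sub_nonneg.2 (hx.2.1 i)
  have hle : ∀ i S, x i S ≤ x i S + if S = ∅ then 1 - ∑ R, x i R else 0 := fun i S => by
    split_ifs
    exacts [le_add_of_nonneg_right (hr i), (add_zero _).ge]
  have hsum : ∀ i, ∑ S, (x i S + if S = ∅ then 1 - ∑ R, x i R else 0) = 1 := fun i => by
    simp [Finset.sum_add_distrib]
  refine ⟨fun i S => x i S + if S = ∅ then 1 - ∑ R, x i R else 0,
    ⟨fun i S => (hx.1 i S).trans (hle i S), fun i => (hsum i).le, fun j => ?_⟩, hsum, hle⟩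
  refine (Eq.le ?_).trans (hx.2.2 j)
  refine Finset.sum_congr rfl fun i _ => Finset.sum_congr rfl fun S hS => ?_
  simp [Finset.ne_empty_of_mem (Finset.mem_filter.1 hS).2]

theorem sum_mul_removeBundle_ge {m : ℕ} {b z p : Finset (Fin m) → ℝ}
    {c : Finset (Fin m) → Fin m → ℝ} (hc : ∀ S R, b S - ∑ j ∈ R, c S j ≤ b (S \ R))
    (hz : ∀ S, 0 ≤ z S) (hp : ∀ R, 0 ≤ p R) (hp1 : ∑ R, p R = 1) :
    ∑ S, b S * z S - ∑ S, z S * ∑ j, c S j *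
        ∑ R ∈ univ.filter (fun R : Finset (Fin m) => j ∈ R), p R
      ≤ ∑ S, b S * removeBundle z p S := by
  rw [sum_mul_removeBundle, ← Finset.sum_sub_distrib]
  refine Finset.sum_le_sum fun S _ => ?_
  have hkey : ∑ R, p R * (b S - ∑ j ∈ R, c S j) = b S - ∑ j, c S j *
      ∑ R ∈ univ.filter (fun R : Finset (Fin m) => j ∈ R), p R := by
    simp only [mul_sub, Finset.sum_sub_distrib, ← Finset.sum_mul, hp1, one_mul]
    congr 1
    simp only [Finset.mul_sum, Finset.sum_filter]
    rw [Finset.sum_comm]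
    refine Finset.sum_congr rfl fun R _ => ?_
    simp only [mul_ite, mul_zero]
    rw [← Finset.sum_filter, Finset.filter_univ_mem]
    exact Finset.sum_congr rfl fun j _ => mul_comm _ _
  have hle : ∑ R, p R * (b S - ∑ j ∈ R, c S j) ≤ ∑ R, p R * b (S \ R) :=
    Finset.sum_le_sum fun R _ => mul_le_mul_of_nonneg_left (hc S R) (hp R)
  rw [hkey] at hle
  have := mul_le_mul_of_nonneg_left hle (hz S)
  linarith

/-- **Lemma 8 of the paper.** The pay-your-bid mechanism that solves the
configuration LP exactly is `(1/2, k+1)`-smooth for deviations to half the value on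
MPH-`k` valuations and bids. -/
theorem configuration_lp_mechanism_half_smooth
    {N : Type*} [Fintype N] [DecidableEq N] (m k : ℕ) (hk : 1 ≤ k)
    (xhat : (N → Finset (Fin m) → ℝ) → (N → Finset (Fin m) → ℝ))
    (hfeas : ∀ b : N → Finset (Fin m) → ℝ, (∀ i, IsMPH m k (b i)) →
      CAFeasible m (fun _ => 1) (xhat b))
    (hopt : ∀ b : N → Finset (Fin m) → ℝ, (∀ i, IsMPH m k (b i)) →
      ∀ y : N → Finset (Fin m) → ℝ, CAFeasible m (fun _ => 1) y →
        ∑ i, ∑ S, b i S * xhat b i S ≥ ∑ i, ∑ S, b i S * y i S)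
    (v b : N → Finset (Fin m) → ℝ)
    (hv : ∀ i, IsMPH m k (v i)) (hb : ∀ i, IsMPH m k (b i)) :
    ∑ i, ∑ S, (v i S - v i S / 2) * xhat (Function.update b i (fun S => v i S / 2)) i S
      ≥ 1 / 2 * caW m v (fun _ => 1) - ((k : ℝ) + 1) * ∑ i, ∑ S, b i S * xhat b i S := by
  have hb' : ∀ i l, IsMPH m k (Function.update b i (fun S => v i S / 2) l) := fun i l => by
    rcases eq_or_ne l i with rfl | h
    · simpa using (hv l).half
    · simpa [h] using hb l
  choose c hc0 hck hcR using fun l S => (hb l).exists_prices S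
  set U := ∑ i, ∑ S, (v i S - v i S / 2) *
    xhat (Function.update b i (fun S => v i S / 2)) i S with hU
  have hz := hfeas b hb
  set z := xhat b
  suffices h : ∀ x, CAFeasible m (fun _ => 1) x →
      ∑ i, ∑ S, v i S * x i S ≤ 2 * (U + ((k : ℝ) + 1) * ∑ i, ∑ S, b i S * z i S) by
    have hsup : caW m v (fun _ => 1) ≤
        2 * (U + ((k : ℝ) + 1) * ∑ i, ∑ S, b i S * z i S) := by
      refine csSup_le ⟨_, 0, ⟨by simp, by simp, by simp⟩, rfl⟩ ?_
      rintro _ ⟨x, hx, rfl⟩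
      exact h x hx
    linarith
  intro x₀ hx₀
  obtain ⟨x, hx, hx1, hle⟩ := hx₀.exists_complete
  have hdom : ∑ i, ∑ S, v i S * x₀ i S ≤ ∑ i, ∑ S, v i S * x i S :=
    Finset.sum_le_sum fun i _ => Finset.sum_le_sum fun S _ =>
      mul_le_mul_of_nonneg_left (hle i S) ((hv i).nonneg S)
  set loss : N → N → ℝ := fun i l => ∑ S, z l S * ∑ j, c l S j *
    ∑ R ∈ univ.filter (fun R : Finset (Fin m) => j ∈ R), x i R with hloss
  have hloss_nonneg : ∀ i l, 0 ≤ loss i l := fun i l => Finset.sum_nonneg fun S _ =>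
    mul_nonneg (hz.1 l S) <| Finset.sum_nonneg fun j _ => mul_nonneg (hc0 l S j) <|
      Finset.sum_nonneg fun R _ => hx.1 i R
  have hloss_sum : ∑ i, ∑ l, loss i l ≤ k * ∑ l, ∑ S, b l S * z l S := by
    rw [Finset.sum_comm, Finset.mul_sum]
    refine Finset.sum_le_sum fun l _ => ?_
    rw [hloss, Finset.sum_comm, Finset.mul_sum]
    refine Finset.sum_le_sum fun S _ => ?_
    rw [← Finset.mul_sum, Finset.sum_comm]
    have hprices : ∑ j, ∑ i, c l S j *
        ∑ R ∈ univ.filter (fun R : Finset (Fin m) => j ∈ R), x i R ≤ k * b l S := by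
      refine le_trans (Finset.sum_le_sum fun j _ => ?_) (hck l S)
      rw [← Finset.mul_sum]
      exact mul_le_of_le_one_right (hc0 l S j) (hx.2.2 j)
    have := mul_le_mul_of_nonneg_left hprices (hz.1 l S)
    linarith
  have hutil : ∀ i, (∑ S, v i S * x i S) / 2 - ∑ S, b i S * z i S - ∑ l, loss i l ≤
      ∑ S, (v i S - v i S / 2) * xhat (Function.update b i (fun S => v i S / 2)) i S := by
    intro i
    have hsplit : ∀ y : N → Finset (Fin m) → ℝ,
        ∑ l, ∑ S, Function.update b i (fun S => v i S / 2) l S * y l S =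
        ∑ S, v i S / 2 * y i S + ∑ l ∈ univ.erase i, ∑ S, b l S * y l S := fun y => by
      rw [← Finset.add_sum_erase _ _ (Finset.mem_univ i), Function.update_self]
      congr 1
      exact Finset.sum_congr rfl fun l hl => by
        rw [Function.update_of_ne (Finset.ne_of_mem_erase hl)]
    have hdev := hopt _ (hb' i) _ (hx.update_removeBundle hz i (hx1 i))
    have hX := hfeas _ (hb' i)
    set X := xhat (Function.update b i (fun S => v i S / 2))
    have hXz := hopt b hb X hX
    have hXi : 0 ≤ ∑ S, b i S * X i S :=
      Finset.sum_nonneg fun S _ => mul_nonneg ((hb i).nonneg S) (hX.1 i S)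
    rw [← Finset.add_sum_erase univ (fun l => ∑ S, b l S * X l S) (Finset.mem_univ i)] at hXz
    have hothers_eq : ∑ l ∈ univ.erase i, ∑ S,
        b l S * Function.update (fun l => removeBundle (z l) (x i)) i (x i) l S =
        ∑ l ∈ univ.erase i, ∑ S, b l S * removeBundle (z l) (x i) S :=
      Finset.sum_congr rfl fun l hl => by
        rw [Function.update_of_ne (Finset.ne_of_mem_erase hl)]
    rw [ge_iff_le, hsplit, hsplit, hothers_eq, Function.update_self] at hdev
    have hothers : ∑ l ∈ univ.erase i, (∑ S, b l S * z l S - loss i l) ≤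
        ∑ l ∈ univ.erase i, ∑ S, b l S * removeBundle (z l) (x i) S :=
      Finset.sum_le_sum fun l _ =>
        sum_mul_removeBundle_ge (hcR l) (hz.1 l) (hx.1 i) (hx1 i)
    rw [Finset.sum_sub_distrib] at hothers
    have hlosses : ∑ l ∈ univ.erase i, loss i l ≤ ∑ l, loss i l :=
      Finset.sum_le_sum_of_subset_of_nonneg (Finset.erase_subset i univ)
        fun l _ _ => hloss_nonneg i l
    have hzsplit :=
      Finset.add_sum_erase univ (fun l => ∑ S, b l S * z l S) (Finset.mem_univ i)
    have hhalf : ∑ S, v i S / 2 * x i S = (∑ S, v i S * x i S) / 2 := by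
      rw [Finset.sum_div]
      exact Finset.sum_congr rfl fun S _ => by ring
    simp only [sub_half]
    linarith
  have htotal := Finset.sum_le_sum fun i (_ : i ∈ univ) => hutil i
  rw [Finset.sum_sub_distrib, Finset.sum_sub_distrib, ← Finset.sum_div, ← hU] at htotal
  linarith
end
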